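/- For every k ≥ 0: consecutive occurrences of the singular word s_k in F_∞ are neither adjacent nor overlapping, and F_∞ = (s_{-1} s_0 ⋯ s_{k-1}) s_{k,1} ν_{s_k,1} s_{k,2} ν_{s_k,2} ⋯, where s_{k,p} is the p-th occurrence of s_k and ν_{s_k,p} the gap following it. The set of gaps {ν_{s_k,p} : p ≥ 1} equals {s_{k+1}, s_{k-1}}; moreover, for every p ≥ 1, ν_{s_k,p} = s_{k+1} if the p-th letter of F_∞ is a, and ν_{s_k,p} = s_{k-1} if the p-th letter of F_∞ is b (so the gap sequence is the Fibonacci word over the alphabet {s_{k+1}, s_{k-1}}). -/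

import Mathlib

/-- Finite Fibonacci words: `Fw k = σ^k(a)` where `a = false`, `b = true`,
`σ(a) = ab`, `σ(b) = a`; so `Fw (k+2) = Fw (k+1) ++ Fw k`. -/
def Fw : ℕ → List Bool
  | 0 => [false]
  | 1 => [false, true]
  | (k+2) => Fw (k+1) ++ Fw k

/-- The infinite Fibonacci word `F_∞` (0-indexed): since `Fw (n+1)` has length
`fib (n+3) > n`, its `n`-th letter is the `n`-th letter of `F_∞`. -/
def fw (n : ℕ) : Bool := (Fw (n+1)).getD n false

/-- Singular words, with index shifted by one: `sw n = s_{n-1}`.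
`sw 0 = s_{-1} = a`, and `sw (n+1) = s_n = β_n · F_n · α_n⁻¹` where
`α_n` is the last letter of `F_n` and `β_n` the other letter. -/
def sw : ℕ → List Bool
  | 0 => [false]
  | (n+1) => (!((Fw n).getLastD false)) :: (Fw n).dropLast

/-- The factor of `F_∞` of length `n` starting at (0-indexed) position `i`. -/
def seg (i n : ℕ) : List Bool := (List.range n).map (fun t => fw (i + t))

/-- `w` occurs in `F_∞` at (0-indexed) position `i`. -/
def OccursAt (w : List Bool) (i : ℕ) : Prop := seg i w.length = w

/-- `w` is a factor of `F_∞`. -/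
def IsFactor (w : List Bool) : Prop := ∃ i, OccursAt w i

/-- Starting position of the `(p+1)`-st occurrence of `w` in `F_∞`
(occurrences enumerated by starting position, 0-indexed: `occPos w 0`
is the first occurrence, i.e. the paper's `ω_1`). -/
noncomputable def occPos (w : List Bool) (p : ℕ) : ℕ := Nat.nth (OccursAt w) p

/-- A finite word viewed as an element of the free group on the alphabet. -/
def listToFree (w : List Bool) : FreeGroup Bool := (w.map FreeGroup.of).prod

/-- The gap `ν_{w,p}` (0-indexed in `p`: `gap w 0` is the paper's `ν_{w,1}`)
between the `(p+1)`-st and `(p+2)`-nd occurrences of `w`, as an element of the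
free group: the separating word if the occurrences are separated or adjacent,
and the formal inverse of the overlap if they overlap. -/
noncomputable def gap (w : List Bool) (p : ℕ) : FreeGroup Bool :=
  if occPos w p + w.length ≤ occPos w (p+1) then
    listToFree (seg (occPos w p + w.length) (occPos w (p+1) - (occPos w p + w.length)))
  else
    (listToFree (seg (occPos w (p+1)) (occPos w p + w.length - occPos w (p+1))))⁻¹

/-- The signed length `|ν_{w,p}|` of the gap (negative in the overlapped case). -/
noncomputable def gapLen (w : List Bool) (p : ℕ) : ℤ :=
  (occPos w (p+1) : ℤ) - ((occPos w p : ℤ) + (w.length : ℤ))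

/-- `u` is a singular word (some `s_k`, `k ≥ -1`). -/
def IsSingular (u : List Bool) : Prop := ∃ n, u = sw n

/-- `u` is a singular kernel of `w`: a singular factor of `w` of maximal length. -/
def IsKernelOf (u w : List Bool) : Prop :=
  IsSingular u ∧ u <:+: w ∧ ∀ v : List Bool, IsSingular v → v <:+: w → v.length ≤ u.length

/-- The excluded words `{ε, ab, ba, aba}`. -/
def excl : List (List Bool) := [[], [false, true], [true, false], [false, true, false]]

/-- The `i`-th conjugate `C_i(w)` (indices taken mod the length). -/
def conj (i : ℕ) (w : List Bool) : List Bool :=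
  w.drop (i % w.length) ++ w.take (i % w.length)

/-- `sliceW u i j = u[i,j]`, the letters `i` through `j` of `u`, 1-indexed. -/
def sliceW (u : List Bool) (i j : ℕ) : List Bool := (u.take j).drop (i - 1)

/-- The Fibonacci substitution `a ↦ ab`, `b ↦ a`. -/
def fibSubst (w : List Bool) : List Bool :=
  w.flatMap fun x => if x then [false] else [false, true]

/-- The concatenation `s_{-1} s_0 ⋯ s_{n-2}` of the first `n` singular words. -/
def singularPrefix (n : ℕ) : List Bool := (List.range n).flatMap sw

/-- The length of the image under the substitution of the prefix of length `n` of `F_∞`. -/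
def substPos (n : ℕ) : ℕ := (fibSubst (seg 0 n)).length

@[simp] theorem fibSubst_nil : fibSubst [] = [] := rfl

@[simp] theorem fibSubst_false_cons (w : List Bool) :
    fibSubst (false :: w) = false :: true :: fibSubst w := rfl

@[simp] theorem fibSubst_true_cons (w : List Bool) :
    fibSubst (true :: w) = false :: fibSubst w := rfl

@[simp] theorem fibSubst_append (u v : List Bool) :
    fibSubst (u ++ v) = fibSubst u ++ fibSubst v := List.flatMap_append

theorem Fw_succ (k : ℕ) : Fw (k + 1) = fibSubst (Fw k) := by
  induction k using Nat.twoStepInduction with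
  | zero => rfl
  | one => rfl
  | more k h₁ h₂ =>
    change Fw (k + 2) ++ Fw (k + 1) = fibSubst (Fw (k + 1) ++ Fw k)
    rw [fibSubst_append, ← h₁, ← h₂]

theorem Fw_prefix_succ (k : ℕ) : Fw k <+: Fw (k + 1) := by
  cases k with
  | zero => exact ⟨[true], rfl⟩
  | succ k => exact ⟨Fw k, rfl⟩

theorem Fw_prefix {j k : ℕ} (h : j ≤ k) : Fw j <+: Fw k := by
  induction k, h using Nat.le_induction with
  | base => exact List.prefix_rfl
  | succ k _ ih => exact ih.trans (Fw_prefix_succ k)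

theorem lt_length_Fw (k : ℕ) : k < (Fw k).length := by
  induction k using Nat.twoStepInduction with
  | zero => simp [Fw]
  | one => simp [Fw]
  | more k h₁ h₂ => rw [Fw, List.length_append]; omega

@[simp] theorem length_seg (i n : ℕ) : (seg i n).length = n := by simp [seg]

theorem Fw_getElem {k n : ℕ} (h : n < (Fw k).length) : (Fw k)[n] = fw n := by
  have hn : n < (Fw (n + 1)).length := (Nat.lt_succ_self n).trans (lt_length_Fw (n + 1))
  rw [fw, List.getD_eq_getElem _ _ hn]
  rcases le_total k (n + 1) with hk | hk
  · exact (Fw_prefix hk).getElem h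
  · exact ((Fw_prefix hk).getElem hn).symm

theorem occursAt_zero_of_prefix {w : List Bool} {k : ℕ} (h : w <+: Fw k) : OccursAt w 0 := by
  refine List.ext_getElem (by simp) fun n _ hn => ?_
  rw [h.getElem hn, Fw_getElem]
  simp [seg]

theorem seg_prefix_Fw (n : ℕ) : seg 0 n <+: Fw n := by
  have h : seg 0 n = (Fw n).take n := by
    refine List.ext_getElem (by simp [(lt_length_Fw n).le]) fun m _ _ => ?_
    rw [List.getElem_take, Fw_getElem]
    simp [seg]
  exact h ▸ List.take_prefix n _

@[simp] theorem occursAt_nil (i : ℕ) : OccursAt [] i := rfl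

@[simp] theorem occursAt_cons (x : Bool) (w : List Bool) (i : ℕ) :
    OccursAt (x :: w) i ↔ fw i = x ∧ OccursAt w (i + 1) := by
  simp [OccursAt, seg, List.range_succ_eq_map, Function.comp_def, add_assoc, add_comm 1]

@[simp] theorem occursAt_append (u v : List Bool) (i : ℕ) :
    OccursAt (u ++ v) i ↔ OccursAt u i ∧ OccursAt v (i + u.length) := by
  induction u generalizing i with
  | nil => simp
  | cons x u ih => simp [ih, and_assoc, add_assoc, add_comm 1]

theorem seg_succ (i n : ℕ) : seg i (n + 1) = seg i n ++ [fw (i + n)] := by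
  simp [seg, List.range_succ]

theorem fibSubst_prefix {u v : List Bool} (h : u <+: v) : fibSubst u <+: fibSubst v := by
  obtain ⟨w, rfl⟩ := h
  exact ⟨fibSubst w, (fibSubst_append u w).symm⟩

theorem occursAt_fibSubst_seg (n : ℕ) : OccursAt (fibSubst (seg 0 n)) 0 :=
  occursAt_zero_of_prefix (k := n + 1) (Fw_succ n ▸ fibSubst_prefix (seg_prefix_Fw n))

@[simp] theorem substPos_zero : substPos 0 = 0 := rfl

theorem substPos_succ (n : ℕ) : substPos (n + 1) = substPos n + (fibSubst [fw n]).length := by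
  simp [substPos, seg_succ]

theorem occursAt_fibSubst_letter (n : ℕ) : OccursAt (fibSubst [fw n]) (substPos n) := by
  have h := occursAt_fibSubst_seg (n + 1)
  rw [seg_succ, fibSubst_append, occursAt_append] at h
  simpa [substPos] using h.2

theorem fw_substPos (n : ℕ) : fw (substPos n) = false := by
  have h := occursAt_fibSubst_letter n
  cases hn : fw n <;> simp_all

theorem fw_substPos_succ (n : ℕ) : fw (substPos n + 1) = !fw n := by
  have h := occursAt_fibSubst_letter n
  have h' := substPos_succ n
  have h'' := fw_substPos (n + 1)
  cases hn : fw n <;> simp_all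

theorem exists_substPos (i : ℕ) :
    ∃ n, i = substPos n ∨ (i = substPos n + 1 ∧ fw n = false) := by
  induction i with
  | zero => exact ⟨0, Or.inl rfl⟩
  | succ i ih =>
    obtain ⟨n, rfl | ⟨rfl, hn⟩⟩ := ih
    · cases hn : fw n
      · exact ⟨n, Or.inr ⟨rfl, hn⟩⟩
      · exact ⟨n + 1, Or.inl (by simp [substPos_succ, hn])⟩
    · exact ⟨n + 1, Or.inl (by simp [substPos_succ, hn])⟩

theorem exists_substPos_of_fw_false {i : ℕ} (h : fw i = false) : ∃ n, i = substPos n := by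
  obtain ⟨n, rfl | ⟨rfl, hn⟩⟩ := exists_substPos i
  · exact ⟨n, rfl⟩
  · simp [fw_substPos_succ, hn] at h

theorem exists_substPos_of_fw_true {i : ℕ} (h : fw i = true) : ∃ n, i = substPos n + 1 := by
  obtain ⟨n, rfl | ⟨rfl, hn⟩⟩ := exists_substPos i
  · simp [fw_substPos] at h
  · exact ⟨n, rfl⟩

theorem fw_succ_of_fw_true {i : ℕ} (h : fw i = true) : fw (i + 1) = false := by
  obtain ⟨n, rfl⟩ := exists_substPos_of_fw_true h
  have hn : fw n = false := by simpa [fw_substPos_succ] using h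
  simpa [substPos_succ, hn] using fw_substPos (n + 1)

theorem substPos_add {w : List Bool} {n : ℕ} (h : OccursAt w n) :
    substPos (n + w.length) = substPos n + (fibSubst w).length := by
  induction w generalizing n with
  | nil => simp
  | cons x w ih =>
    rw [occursAt_cons] at h
    have h₁ := ih h.2
    have h₂ := substPos_succ n
    rw [List.length_cons, add_comm w.length 1, ← add_assoc, h₁, h₂, h.1]
    cases x <;> simp <;> omega

theorem occursAt_fibSubst_iff (w : List Bool) (n : ℕ) :
    OccursAt (fibSubst w ++ [false]) (substPos n) ↔ OccursAt w n := by
  induction w generalizing n with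
  | nil => simp [fw_substPos]
  | cons x w ih =>
    have hs := substPos_succ n
    have hstart (i : ℕ) (h : OccursAt (fibSubst w ++ [false]) i) : fw i = false := by
      rcases w with _ | ⟨_ | _, w⟩ <;> simp_all
    rw [occursAt_cons, ← ih]
    cases x
    · rw [fibSubst_false_cons, List.cons_append, List.cons_append, occursAt_cons, occursAt_cons,
        fw_substPos_succ]
      cases hn : fw n <;> simp_all [fw_substPos, add_assoc]
    · rw [fibSubst_true_cons, List.cons_append, occursAt_cons]
      cases hn : fw n
      · have h : fw (substPos n + 1) = true := by rw [fw_substPos_succ, hn]; rfl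
        refine iff_of_false (fun h' => ?_) (by simp)
        simp [hstart _ h'.2] at h
      · simp_all [fw_substPos]

/-- The occurrences of `w` in `F_∞` are separated by `u` and `v` according to the letters
of `F_∞`, and the first one comes right after the prefix `pre`. -/
def HasFibonacciGaps (w u v pre : List Bool) : Prop :=
  ∃ Q : ℕ → ℕ, Q 0 = pre.length ∧ OccursAt pre 0 ∧ (∀ i, OccursAt w i ↔ ∃ p, Q p = i) ∧
    ∀ p, OccursAt (w ++ if fw p then v else u) (Q p) ∧
      Q (p + 1) = Q p + (w ++ if fw p then v else u).length

theorem HasFibonacciGaps.fibSubst_append {w u v pre u' v' : List Bool}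
    (h : HasFibonacciGaps w u v pre) (hu : fibSubst u = false :: u')
    (hv : fibSubst v = false :: v') :
    HasFibonacciGaps (fibSubst w ++ [false]) u' v' (fibSubst pre) := by
  obtain ⟨Q, hQ, hpre, hocc, hgap⟩ := h
  refine ⟨fun p => substPos (Q p), ?_, ?_, fun i => ⟨fun hi => ?_, ?_⟩, fun p => ?_⟩
  · simpa [hQ] using substPos_add hpre
  · exact ((occursAt_append _ _ _).1 ((occursAt_fibSubst_iff pre 0).2 hpre)).1
  · have : fw i = false := by rcases w with _ | ⟨_ | _, w⟩ <;> simp_all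
    obtain ⟨n, rfl⟩ := exists_substPos_of_fw_false this
    obtain ⟨p, rfl⟩ := (hocc n).1 ((occursAt_fibSubst_iff w n).1 hi)
    exact ⟨p, rfl⟩
  · rintro ⟨p, rfl⟩
    exact (occursAt_fibSubst_iff w _).2 ((hocc _).2 ⟨p, rfl⟩)
  · obtain ⟨h₁, h₂⟩ := hgap p
    have h₃ := substPos_add h₁
    have h₄ := (occursAt_fibSubst_iff _ _).2 h₁
    have hg : fibSubst (w ++ if fw p then v else u) =
        (fibSubst w ++ [false]) ++ if fw p then v' else u' := by
      cases fw p <;> simp [hu, hv]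
    rw [hg] at h₃ h₄
    exact ⟨((occursAt_append _ _ _).1 h₄).1, by simpa only [h₂] using h₃⟩

theorem HasFibonacciGaps.of_fibSubst_eq_cons {w u v pre x y w' : List Bool}
    (h : HasFibonacciGaps w u v pre) (hx : w = false :: x) (hy : w = y ++ [false])
    (hw : fibSubst w = false :: w') :
    HasFibonacciGaps w' (fibSubst u ++ [false]) (fibSubst v ++ [false])
      (fibSubst pre ++ [false]) := by
  obtain ⟨Q, hQ, hpre, hocc, hgap⟩ := h
  refine ⟨fun p => substPos (Q p) + 1, ?_, ?_, fun i => ⟨fun hi => ?_, ?_⟩, fun p => ?_⟩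
  · simpa [hQ] using substPos_add hpre
  · exact (occursAt_fibSubst_iff pre 0).2 hpre
  · have hi' : fw i = true := by
      rw [hx, fibSubst_false_cons, List.cons.injEq] at hw
      rw [← hw.2] at hi
      exact ((occursAt_cons _ _ _).1 hi).1
    obtain ⟨n, rfl⟩ := exists_substPos_of_fw_true hi'
    have hn : OccursAt (fibSubst w) (substPos n) := by
      rw [hw, occursAt_cons]
      exact ⟨fw_substPos n, hi⟩
    have hn' : OccursAt (fibSubst w ++ [false]) (substPos n) := by
      refine (occursAt_append _ _ _).2 ⟨hn, ?_⟩
      have hy' : fibSubst w = (fibSubst y ++ [false]) ++ [true] := by simp [hy]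
      rw [hy', occursAt_append] at hn
      have := fw_succ_of_fw_true ((occursAt_cons _ _ _).1 hn.2).1
      rw [hy', List.length_append, occursAt_cons]
      exact ⟨this, rfl⟩
    obtain ⟨p, rfl⟩ := (hocc n).1 ((occursAt_fibSubst_iff w n).1 hn')
    exact ⟨p, rfl⟩
  · rintro ⟨p, rfl⟩
    have := (occursAt_fibSubst_iff w _).2 ((hocc _).2 ⟨p, rfl⟩)
    rw [occursAt_append, hw, occursAt_cons] at this
    exact this.1.2
  · obtain ⟨h₁, h₂⟩ := hgap p
    have h₃ := substPos_add h₁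
    have h₄ := (occursAt_fibSubst_iff _ _).2 h₁
    have hg : fibSubst (w ++ if fw p then v else u) ++ [false] =
        false :: (w' ++ if fw p then fibSubst v ++ [false] else fibSubst u ++ [false]) := by
      cases fw p <;> simp [hw]
    have hl := congrArg List.length hg
    rw [hg, occursAt_cons] at h₄
    refine ⟨h₄.2, ?_⟩
    rw [List.length_append, List.length_singleton, List.length_cons] at hl
    dsimp only
    rw [h₂, h₃]
    omega

theorem Fw_even_odd (m : ℕ) :
    ∃ x, Fw (2 * m) = x ++ [false] ∧ Fw (2 * m + 1) = fibSubst x ++ [false, true] := by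
  induction m with
  | zero => exact ⟨[], rfl, rfl⟩
  | succ m ih =>
    obtain ⟨x, -, h⟩ := ih
    have h' : Fw (2 * (m + 1)) = fibSubst (fibSubst x ++ [false]) ++ [false] := by
      rw [mul_add, mul_one, Fw_succ, h]
      simp
    exact ⟨_, h', by rw [Fw_succ, h']; simp⟩

theorem fibSubst_sw_odd (m : ℕ) : fibSubst (sw (2 * m + 1)) ++ [false] = sw (2 * m + 2) := by
  obtain ⟨x, h₁, h₂⟩ := Fw_even_odd m
  rw [sw, sw, h₁, h₂]
  simp [List.dropLast_append_of_ne_nil]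

theorem fibSubst_sw_even (m : ℕ) : fibSubst (sw (2 * m)) = false :: sw (2 * m + 1) := by
  cases m with
  | zero => rfl
  | succ m =>
    obtain ⟨x, h₁, h₂⟩ := Fw_even_odd m
    rw [mul_add, mul_one, sw, sw, Fw_succ (2 * m + 1), h₂]
    simp [List.dropLast_append_of_ne_nil]

theorem sw_even_start_end (m : ℕ) :
    (∃ x, sw (2 * m) = false :: x) ∧ ∃ y, sw (2 * m) = y ++ [false] := by
  cases m with
  | zero => exact ⟨⟨[], rfl⟩, [], rfl⟩
  | succ m =>
    refine ⟨?_, fibSubst (sw (2 * m + 1)), (fibSubst_sw_odd m).symm⟩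
    obtain ⟨x, -, h₂⟩ := Fw_even_odd m
    rw [mul_add, mul_one, sw, h₂]
    simp

theorem singularPrefix_succ (n : ℕ) : singularPrefix (n + 1) = singularPrefix n ++ sw n := by
  simp [singularPrefix, List.range_succ]

theorem fibSubst_singularPrefix (m : ℕ) :
    fibSubst (singularPrefix (2 * m)) ++ [false] = singularPrefix (2 * m + 1) ∧
    fibSubst (singularPrefix (2 * m + 1)) = singularPrefix (2 * m + 2) := by
  have odd_step (m : ℕ) (h : fibSubst (singularPrefix (2 * m)) ++ [false] =
      singularPrefix (2 * m + 1)) :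
      fibSubst (singularPrefix (2 * m + 1)) = singularPrefix (2 * m + 2) := by
    rw [singularPrefix_succ (2 * m + 1), ← h, List.append_assoc, List.singleton_append,
      ← fibSubst_sw_even, ← fibSubst_append, ← singularPrefix_succ, h]
  induction m with
  | zero => exact ⟨rfl, rfl⟩
  | succ m ih =>
    have h : fibSubst (singularPrefix (2 * (m + 1))) ++ [false] =
        singularPrefix (2 * (m + 1) + 1) := by
      rw [mul_add, mul_one, singularPrefix_succ (2 * m + 1), fibSubst_append, ih.2,
        List.append_assoc, fibSubst_sw_odd, ← singularPrefix_succ]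
    exact ⟨h, odd_step _ h⟩

theorem hasFibonacciGaps_singleton : HasFibonacciGaps [false] [true] [] [] := by
  refine ⟨substPos, rfl, rfl, fun i => ⟨fun hi => ?_, ?_⟩, fun p => ?_⟩
  · obtain ⟨n, rfl⟩ := exists_substPos_of_fw_false ((occursAt_cons _ _ _).1 hi).1
    exact ⟨n, rfl⟩
  · rintro ⟨p, rfl⟩
    simp [fw_substPos]
  · have h₁ := fw_substPos_succ p
    have h₂ := substPos_succ p
    cases hp : fw p <;> simp_all [fw_substPos]

theorem hasFibonacciGaps_sw_odd_of_even {m : ℕ} {v : List Bool}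
    (hv : fibSubst v ++ [false] = sw (2 * m))
    (h : HasFibonacciGaps (sw (2 * m)) (sw (2 * m + 1)) v (singularPrefix (2 * m))) :
    HasFibonacciGaps (sw (2 * m + 1)) (sw (2 * m + 2)) (sw (2 * m))
      (singularPrefix (2 * m + 1)) := by
  obtain ⟨⟨x, hx⟩, y, hy⟩ := sw_even_start_end m
  have := h.of_fibSubst_eq_cons hx hy (fibSubst_sw_even m)
  rwa [hv, fibSubst_sw_odd, (fibSubst_singularPrefix m).1] at this

theorem hasFibonacciGaps_sw_even_of_odd {m : ℕ}
    (h : HasFibonacciGaps (sw (2 * m + 1)) (sw (2 * m + 2)) (sw (2 * m))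
      (singularPrefix (2 * m + 1))) :
    HasFibonacciGaps (sw (2 * m + 2)) (sw (2 * m + 3)) (sw (2 * m + 1))
      (singularPrefix (2 * m + 2)) := by
  have := h.fibSubst_append (fibSubst_sw_even (m + 1)) (fibSubst_sw_even m)
  rwa [fibSubst_sw_odd, (fibSubst_singularPrefix m).2] at this

theorem exists_hasFibonacciGaps_sw_even (m : ℕ) :
    ∃ v, fibSubst v ++ [false] = sw (2 * m) ∧
      HasFibonacciGaps (sw (2 * m)) (sw (2 * m + 1)) v (singularPrefix (2 * m)) := by
  induction m with
  | zero => exact ⟨[], rfl, hasFibonacciGaps_singleton⟩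
  | succ m ih =>
    obtain ⟨v, hv, h⟩ := ih
    exact ⟨sw (2 * m + 1), fibSubst_sw_odd m,
      hasFibonacciGaps_sw_even_of_odd (hasFibonacciGaps_sw_odd_of_even hv h)⟩

theorem hasFibonacciGaps_sw (k : ℕ) :
    HasFibonacciGaps (sw (k + 1)) (sw (k + 2)) (sw k) (singularPrefix (k + 1)) := by
  have odd_case (m : ℕ) := (exists_hasFibonacciGaps_sw_even m).elim fun v h =>
    hasFibonacciGaps_sw_odd_of_even h.1 h.2
  obtain ⟨m, rfl | rfl⟩ := Nat.even_or_odd' k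
  · exact odd_case m
  · exact hasFibonacciGaps_sw_even_of_odd (odd_case m)

theorem occPos_eq_of_strictMono {w : List Bool} {Q : ℕ → ℕ} (hQ : StrictMono Q)
    (hocc : ∀ i, OccursAt w i ↔ ∃ p, Q p = i) : occPos w = Q := by
  have hset : {i | OccursAt w i} = Set.range Q := Set.ext hocc
  have hinf : {i | OccursAt w i}.Infinite := hset ▸ Set.infinite_range_of_injective hQ.injective
  refine ((Nat.nth_strictMono hinf).range_inj hQ).1 ?_
  rw [← hset]
  exact Nat.range_nth_of_infinite hinf

theorem length_sw_pos (n : ℕ) : 0 < (sw n).length := by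
  cases n <;> simp [sw]

/-- for every `k ≥ 0`, consecutive occurrences of `s_k` in `F_∞` are
neither adjacent nor overlapped; the first occurrence of `s_k` starts right after
the prefix `s_{-1} s_0 ⋯ s_{k-1}`; the set of gaps of `s_k` is `{s_{k+1}, s_{k-1}}`;
and `ν_{s_k,p} = s_{k+1}` if the `p`-th letter of `F_∞` is `a`, `= s_{k-1}` if it is `b`
(so the gap sequence is the Fibonacci word over `{s_{k+1}, s_{k-1}}`). -/
theorem stmt2 (k : ℕ) :
    (∀ p : ℕ, occPos (sw (k+1)) p + (sw (k+1)).length < occPos (sw (k+1)) (p+1)) ∧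
    occPos (sw (k+1)) 0 = ((List.range (k+1)).map (fun j => (sw j).length)).sum ∧
    ({g : FreeGroup Bool | ∃ p : ℕ, gap (sw (k+1)) p = g}
      = {listToFree (sw (k+2)), listToFree (sw k)}) ∧
    (∀ p : ℕ, gap (sw (k+1)) p =
      if fw p = false then listToFree (sw (k+2)) else listToFree (sw k)) := by
  obtain ⟨Q, hQ, -, hocc, hgap⟩ := hasFibonacciGaps_sw k
  have hlen (p : ℕ) : Q p + (sw (k+1)).length < Q (p+1) := by
    have h₁ := length_sw_pos k
    have h₂ := length_sw_pos (k + 2)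
    rw [(hgap p).2]
    cases fw p <;> simp [h₁, h₂]
  have hpos : occPos (sw (k+1)) = Q :=
    occPos_eq_of_strictMono (strictMono_nat_of_lt_succ fun p =>
      (Nat.le_add_right _ _).trans_lt (hlen p)) hocc
  have hval (p : ℕ) : gap (sw (k+1)) p =
      if fw p = false then listToFree (sw (k+2)) else listToFree (sw k) := by
    obtain ⟨h₁, h₂⟩ := hgap p
    have h₃ := ((occursAt_append _ _ _).1 h₁).2
    rw [gap, hpos, if_pos (hlen p).le, h₂, List.length_append, ← add_assoc,
      Nat.add_sub_cancel_left, h₃]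
    cases fw p <;> rfl
  refine ⟨hpos ▸ hlen, ?_, ?_, hval⟩
  · rw [hpos, hQ, singularPrefix, List.length_flatMap]
  · ext g
    constructor
    · rintro ⟨p, rfl⟩
      rw [hval]
      split_ifs <;> simp
    · rintro (rfl | rfl)
      · exact ⟨0, hval 0⟩
      · exact ⟨1, hval 1⟩
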